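/- arXiv:1801.01826 — 3 statements merged into one kernel-verified Lean document; each statement's English description precedes it below -/
import Mathlib

section
/- Let X and Y be Polish spaces. Then the relation {(A, B) ∈ K(X) × K(Y) : B is homeomorphic to A} is an analytic subset of K(X) × K(Y), and the relation {(A, B) ∈ K(X) × K(Y) : B is a continuous image of A, i.e. there is a continuous surjection from A onto B} is an analytic subset of K(X) × K(Y). -/
open TopologicalSpace

/-- A continuous map injective on a compact set restricts to a homeomorphism onto its image. -/
theorem nonempty_homeomorph_image_of_injOn {Z W : Type*} [TopologicalSpace Z] [TopologicalSpace W]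
    [T2Space W] {f : Z → W} (hf : Continuous f) {K : Set Z} (hK : IsCompact K)
    (h : Set.InjOn f K) : Nonempty (K ≃ₜ f '' K) := by
  have : CompactSpace K := isCompact_iff_compactSpace.mp hK
  have hc : Continuous (Equiv.Set.imageOfInjOn f K h) :=
    Continuous.subtype_mk (hf.comp continuous_subtype_val) _
  exact ⟨hc.homeoOfEquivCompactToT2⟩

/-- The compact sets on which a given continuous map is injective form a `Gδ` set. -/
theorem isGδ_setOf_injOn_nonemptyCompacts {Z W : Type*} [MetricSpace Z] [TopologicalSpace W]
    [T2Space W] {f : Z → W} (hf : Continuous f) :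
    IsGδ {K : NonemptyCompacts Z | Set.InjOn f (K : Set Z)} := by
  let F : ℕ → Set (Z × Z) := fun n => {p | f p.1 = f p.2 ∧ 1 / ((n : ℝ) + 1) ≤ dist p.1 p.2}
  have hF : ∀ n, IsClosed (F n) := fun n =>
    (isClosed_eq (hf.comp continuous_fst) (hf.comp continuous_snd)).inter
      (isClosed_le continuous_const continuous_dist)
  have hclosed : ∀ n, IsClosed
      {K : NonemptyCompacts Z | (((K ×ˢ K : NonemptyCompacts (Z × Z)) : Set (Z × Z)) ∩
        F n).Nonempty} := fun n =>
    (NonemptyCompacts.isClosed_inter_nonempty_of_isClosed (hF n)).preimage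
      (NonemptyCompacts.continuous_prod.comp (continuous_id.prodMk continuous_id))
  have heq : {K : NonemptyCompacts Z | Set.InjOn f (K : Set Z)} =
      ⋂ n, {K : NonemptyCompacts Z | (((K ×ˢ K : NonemptyCompacts (Z × Z)) : Set (Z × Z)) ∩
        F n).Nonempty}ᶜ := by
    ext K
    simp only [Set.mem_ofPred_eq, Set.mem_iInter, Set.mem_compl_iff]
    constructor
    · rintro h n ⟨⟨p, q⟩, ⟨hp, hq⟩, hfpq, hd⟩
      have hpq : p = q := h hp hq hfpq
      have hpos : (0 : ℝ) < 1 / ((n : ℝ) + 1) := Nat.one_div_pos_of_nat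
      simp only [hpq, dist_self] at hd
      linarith
    · intro h p hp q hq hfpq
      by_contra hne
      obtain ⟨n, hn⟩ := exists_nat_one_div_lt (dist_pos.mpr hne)
      exact h n ⟨(p, q), ⟨hp, hq⟩, hfpq, hn.le⟩
  rw [heq]
  exact IsGδ.iInter_of_isOpen fun n => (hclosed n).isOpen_compl

/-- The nonempty compact subsets of a Polish space form a Polish space. -/
theorem polishSpace_nonemptyCompacts (Z : Type*) [TopologicalSpace Z] [PolishSpace Z] :
    PolishSpace (NonemptyCompacts Z) := by
  let := upgradeIsCompletelyMetrizable Z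
  infer_instance

/-- The pairs of projections of the compact sets in a `Gδ` set form an analytic set. -/
theorem IsGδ.analyticSet_setOf_projections {X Y : Type*} [TopologicalSpace X] [PolishSpace X]
    [TopologicalSpace Y] [PolishSpace Y] {S : Set (NonemptyCompacts (X × Y))} (hS : IsGδ S) :
    MeasureTheory.AnalyticSet {p : NonemptyCompacts X × NonemptyCompacts Y |
      ∃ G ∈ S, Prod.fst '' (G : Set (X × Y)) = p.1 ∧ Prod.snd '' (G : Set (X × Y)) = p.2} := by
  have := polishSpace_nonemptyCompacts (X × Y)
  borelize (NonemptyCompacts (X × Y))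
  convert (hS.measurableSet.analyticSet).image_of_continuous
    ((continuous_fst.nonemptyCompacts_map).prodMk (continuous_snd.nonemptyCompacts_map)) using 1
  ext ⟨A, B⟩
  simp only [Set.mem_ofPred_eq, Set.mem_image, Prod.mk.injEq, ← SetLike.coe_set_eq,
    NonemptyCompacts.coe_map]

/-- The graph of a continuous map between subsets, viewed as a compact subset of the product. -/
theorem exists_nonemptyCompacts_graph {X Y : Type*} [TopologicalSpace X] [TopologicalSpace Y]
    (A : NonemptyCompacts X) {B : Set Y} {f : ↥(A : Set X) → B} (hf : Continuous f) :
    ∃ G : NonemptyCompacts (X × Y),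
      (G : Set (X × Y)) = Set.range fun a : ↥(A : Set X) => ((a : X), (f a : Y)) := by
  have : CompactSpace (A : Set X) := isCompact_iff_compactSpace.mp A.isCompact
  have : Nonempty (A : Set X) := A.nonempty.to_subtype
  exact ⟨⟨⟨_, isCompact_range (by fun_prop)⟩, Set.range_nonempty _⟩, rfl⟩

/-- A compact set is a continuous image of another iff some compact subset of the product is the
graph of a surjection between them. -/
theorem exists_continuous_surjective_iff {X Y : Type*} [TopologicalSpace X] [T2Space X]
    [TopologicalSpace Y] (A : NonemptyCompacts X) (B : NonemptyCompacts Y) :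
    (∃ f : ↥(A : Set X) → ↥(B : Set Y), Continuous f ∧ Function.Surjective f) ↔
      ∃ G ∈ {G : NonemptyCompacts (X × Y) | Set.InjOn Prod.fst (G : Set (X × Y))},
        Prod.fst '' (G : Set (X × Y)) = A ∧ Prod.snd '' (G : Set (X × Y)) = B := by
  constructor
  · rintro ⟨f, hf, hs⟩
    obtain ⟨G, hG⟩ := exists_nonemptyCompacts_graph A hf
    refine ⟨G, ?_, ?_, ?_⟩
    · rw [Set.mem_ofPred_eq, hG]
      rintro _ ⟨a, rfl⟩ _ ⟨b, rfl⟩ hab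
      rw [Subtype.ext hab]
    · rw [hG, ← Set.range_comp]
      exact Subtype.range_coe
    · rw [hG, ← Set.range_comp]
      exact (hs.range_comp Subtype.val).trans Subtype.range_coe
  · rintro ⟨G, hG, hA, hB⟩
    obtain ⟨e⟩ := nonempty_homeomorph_image_of_injOn continuous_fst G.isCompact hG
    rw [← hA, ← hB]
    refine ⟨fun a => ⟨(e.symm a : X × Y).2, Set.mem_image_of_mem _ (e.symm a).2⟩, by fun_prop, ?_⟩
    rintro ⟨_, p, hp, rfl⟩
    exact ⟨e ⟨p, hp⟩, by simp⟩

/-- Two compact sets are homeomorphic iff some compact subset of the product is the graph of a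
bijection between them. -/
theorem nonempty_homeomorph_iff {X Y : Type*} [TopologicalSpace X] [T2Space X]
    [TopologicalSpace Y] [T2Space Y] (A : NonemptyCompacts X) (B : NonemptyCompacts Y) :
    Nonempty (↥(A : Set X) ≃ₜ ↥(B : Set Y)) ↔
      ∃ G ∈ {G : NonemptyCompacts (X × Y) | Set.InjOn Prod.fst (G : Set (X × Y))} ∩
          {G : NonemptyCompacts (X × Y) | Set.InjOn Prod.snd (G : Set (X × Y))},
        Prod.fst '' (G : Set (X × Y)) = A ∧ Prod.snd '' (G : Set (X × Y)) = B := by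
  constructor
  · rintro ⟨f⟩
    obtain ⟨G, hG⟩ := exists_nonemptyCompacts_graph A f.continuous
    refine ⟨G, ⟨?_, ?_⟩, ?_, ?_⟩
    · rw [Set.mem_ofPred_eq, hG]
      rintro _ ⟨a, rfl⟩ _ ⟨b, rfl⟩ hab
      rw [Subtype.ext hab]
    · rw [Set.mem_ofPred_eq, hG]
      rintro _ ⟨a, rfl⟩ _ ⟨b, rfl⟩ hab
      rw [f.injective (Subtype.ext hab)]
    · rw [hG, ← Set.range_comp]
      exact Subtype.range_coe
    · rw [hG, ← Set.range_comp]
      exact (f.surjective.range_comp Subtype.val).trans Subtype.range_coe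
  · rintro ⟨G, ⟨hG₁, hG₂⟩, hA, hB⟩
    obtain ⟨e₁⟩ := nonempty_homeomorph_image_of_injOn continuous_fst G.isCompact hG₁
    obtain ⟨e₂⟩ := nonempty_homeomorph_image_of_injOn continuous_snd G.isCompact hG₂
    rw [← hA, ← hB]
    exact ⟨e₁.symm.trans e₂⟩

/-- For Polish spaces `X` and `Y`, the relation "B is homeomorphic to A" and the relation
"B is a continuous image of A" are analytic subsets of `K(X) × K(Y)`. -/
theorem homeo_and_image_relations_analytic
    (X Y : Type*) [MetricSpace X] [PolishSpace X] [MetricSpace Y] [PolishSpace Y] :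
    MeasureTheory.AnalyticSet {p : NonemptyCompacts X × NonemptyCompacts Y |
      Nonempty (↥(p.1 : Set X) ≃ₜ ↥(p.2 : Set Y))} ∧
    MeasureTheory.AnalyticSet {p : NonemptyCompacts X × NonemptyCompacts Y |
      ∃ f : ↥(p.1 : Set X) → ↥(p.2 : Set Y), Continuous f ∧ Function.Surjective f} := by
  have hfst := isGδ_setOf_injOn_nonemptyCompacts (continuous_fst (X := X) (Y := Y))
  have hsnd := isGδ_setOf_injOn_nonemptyCompacts (continuous_snd (X := X) (Y := Y))
  constructor
  · simpa only [nonempty_homeomorph_iff] using (hfst.inter hsnd).analyticSet_setOf_projections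
  · simpa only [exists_continuous_surjective_iff] using hfst.analyticSet_setOf_projections
end

section
/- For each n ∈ ℕ let F_n be an analytic subset of the hyperspace K(Q) of nonempty compact subsets of the Hilbert cube Q = [0,1]^ℕ. Then the intersection ⋂_{n ∈ ℕ} {K ∈ K(Q) : K is homeomorphic to some member of F_n} is an analytic subset of K(Q). -/
open TopologicalSpace

/-- A metric on the Hilbert cube `[0,1]^ℕ` inducing the product topology. -/
noncomputable instance : MetricSpace (ℕ → unitInterval) := PiCountable.metricSpace

open MeasureTheory

/-- The nonempty compact sets on which a continuous map is injective form a `Gδ` subset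
of the hyperspace. -/
theorem isGδ_setOf_nonemptyCompacts_injOn {X Y : Type*} [TopologicalSpace X] [MetrizableSpace X]
    [TopologicalSpace Y] [T2Space Y] {f : X → Y} (hf : Continuous f) :
    IsGδ {K : NonemptyCompacts X | Set.InjOn f K} := by
  let _ := metrizableSpaceMetric X
  have hdist : ∀ n : ℕ, IsOpen {K : NonemptyCompacts X | ¬ (((K ×ˢ K : NonemptyCompacts (X × X)) :
      Set (X × X)) ∩ {p | f p.1 = f p.2 ∧ 1 / ((n : ℝ) + 1) ≤ dist p.1 p.2}).Nonempty} := by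
    intro n
    have hclosed : IsClosed {p : X × X | f p.1 = f p.2 ∧ 1 / ((n : ℝ) + 1) ≤ dist p.1 p.2} :=
      (isClosed_eq (hf.comp continuous_fst) (hf.comp continuous_snd)).inter
        (isClosed_le continuous_const continuous_dist)
    exact ((NonemptyCompacts.isClosed_inter_nonempty_of_isClosed hclosed).preimage
      (NonemptyCompacts.continuous_prod.comp (continuous_id.prodMk continuous_id))).isOpen_compl
  convert IsGδ.iInter_of_isOpen hdist using 1
  ext K
  simp only [Set.mem_ofPred_eq, Set.mem_iInter, Set.not_nonempty_iff_eq_empty,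
    Set.eq_empty_iff_forall_notMem]
  constructor
  · rintro hK n p ⟨hp, hfp, hnp⟩
    rw [NonemptyCompacts.coe_prod] at hp
    rw [hK hp.1 hp.2 hfp, dist_self] at hnp
    exact absurd hnp (not_le.2 Nat.one_div_pos_of_nat)
  · intro hK x hx y hy hxy
    by_contra hne
    obtain ⟨n, hn⟩ := exists_nat_one_div_lt (dist_pos.2 hne)
    refine hK n (x, y) ⟨?_, hxy, hn.le⟩
    rw [NonemptyCompacts.coe_prod]
    exact ⟨hx, hy⟩

/-- A continuous map which is injective on a nonempty compact set restricts to a homeomorphism onto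
the image of this set. -/
theorem TopologicalSpace.NonemptyCompacts.nonempty_homeomorph_map_of_injOn {X Y : Type*}
    [TopologicalSpace X] [TopologicalSpace Y] [T2Space Y] (K : NonemptyCompacts X) {f : X → Y}
    (hf : Continuous f) (hinj : Set.InjOn f K) :
    Nonempty ((K : Set X) ≃ₜ (K.map f hf : Set Y)) := by
  have : CompactSpace (K : Set X) := isCompact_iff_compactSpace.1 K.isCompact
  have hc : Continuous (hinj.bijOn_image.equiv f) :=
    (hf.comp continuous_subtype_val).subtype_mk _
  exact ⟨hc.homeoOfEquivCompactToT2⟩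

/-- Two nonempty compact subsets of Hausdorff spaces are homeomorphic exactly when some nonempty
compact subset of the product projects injectively onto both. -/
theorem nonempty_homeomorph_iff_exists_nonemptyCompacts_prod {X Y : Type*} [TopologicalSpace X]
    [T2Space X] [TopologicalSpace Y] [T2Space Y] (K : NonemptyCompacts X)
    (L : NonemptyCompacts Y) :
    Nonempty ((K : Set X) ≃ₜ (L : Set Y)) ↔
      ∃ R : NonemptyCompacts (X × Y), Set.InjOn Prod.fst (R : Set (X × Y)) ∧
        Set.InjOn Prod.snd (R : Set (X × Y)) ∧
        R.map Prod.fst continuous_fst = K ∧ R.map Prod.snd continuous_snd = L := by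
  constructor
  · rintro ⟨e⟩
    have : CompactSpace (K : Set X) := isCompact_iff_compactSpace.1 K.isCompact
    have : Nonempty (K : Set X) := K.nonempty.to_subtype
    have hc : Continuous fun x : (K : Set X) => ((x : X), (e x : Y)) := by fun_prop
    refine ⟨⟨⟨Set.range fun x : (K : Set X) => ((x : X), (e x : Y)), isCompact_range hc⟩,
      Set.range_nonempty _⟩, ?_, ?_, ?_, ?_⟩
    · rintro _ ⟨x, rfl⟩ _ ⟨y, rfl⟩ hxy
      rw [Subtype.ext hxy]
    · rintro _ ⟨x, rfl⟩ _ ⟨y, rfl⟩ hxy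
      rw [e.injective (Subtype.ext hxy)]
    · ext x
      simp [← SetLike.mem_coe, ← Set.range_comp]
    · ext y
      simp only [NonemptyCompacts.coe_map]
      constructor
      · rintro ⟨_, ⟨x, rfl⟩, rfl⟩
        exact (e x).2
      · intro hy
        exact ⟨_, ⟨e.symm ⟨y, hy⟩, rfl⟩, by simp⟩
  · rintro ⟨R, hfst, hsnd, rfl, rfl⟩
    obtain ⟨e⟩ := R.nonempty_homeomorph_map_of_injOn continuous_fst hfst
    obtain ⟨e'⟩ := R.nonempty_homeomorph_map_of_injOn continuous_snd hsnd
    exact ⟨e.symm.trans e'⟩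

/-- The intersection of two analytic sets in a Hausdorff space is analytic. -/
theorem MeasureTheory.AnalyticSet.inter {X : Type*} [TopologicalSpace X] [T2Space X]
    {s t : Set X} (hs : AnalyticSet s) (ht : AnalyticSet t) : AnalyticSet (s ∩ t) := by
  rw [Set.inter_eq_iInter]
  exact AnalyticSet.iInter (Bool.forall_bool.2 ⟨ht, hs⟩)

/-- In a compact metrizable space, the homeomorphism-saturation of an analytic family of nonempty
compact sets is analytic. -/
theorem MeasureTheory.AnalyticSet.homeomorphism_saturation {X : Type*} [TopologicalSpace X]
    [CompactSpace X] [MetrizableSpace X] {F : Set (NonemptyCompacts X)} (hF : AnalyticSet F) :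
    AnalyticSet {K : NonemptyCompacts X | ∃ C ∈ F, Nonempty ((K : Set X) ≃ₜ (C : Set X))} := by
  have : SecondCountableTopology X := by
    let _ := metrizableSpaceMetric X
    infer_instance
  have : PolishSpace (NonemptyCompacts (X × X)) := by
    let _ := metrizableSpaceMetric X
    infer_instance
  borelize (NonemptyCompacts (X × X))
  have hfst : AnalyticSet {R : NonemptyCompacts (X × X) | Set.InjOn Prod.fst (R : Set (X × X))} :=
    (isGδ_setOf_nonemptyCompacts_injOn continuous_fst).measurableSet.analyticSet
  have hsnd : AnalyticSet {R : NonemptyCompacts (X × X) | Set.InjOn Prod.snd (R : Set (X × X))} :=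
    (isGδ_setOf_nonemptyCompacts_injOn continuous_snd).measurableSet.analyticSet
  have hpre := hF.preimage (continuous_snd (X := X) (Y := X)).nonemptyCompacts_map
  convert! ((hfst.inter hsnd).inter hpre).image_of_continuous
    (continuous_fst (X := X) (Y := X)).nonemptyCompacts_map using 1
  ext K
  simp only [Set.mem_ofPred_eq, nonempty_homeomorph_iff_exists_nonemptyCompacts_prod]
  constructor
  · rintro ⟨_, hC, R, hR₁, hR₂, hK, rfl⟩
    exact ⟨R, ⟨⟨hR₁, hR₂⟩, hC⟩, hK⟩
  · rintro ⟨R, ⟨⟨hR₁, hR₂⟩, hC⟩, hK⟩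
    exact ⟨_, hC, R, hR₁, hR₂, hK, rfl⟩

/-- If for each `n`, `Fₙ` is an analytic family in the hyperspace `K(Q)` of nonempty
compact subsets of the Hilbert cube `Q = [0,1]^ℕ`, then the intersection over `n` of the
homeomorphism-saturations of the families `Fₙ` is analytic in `K(Q)`. -/
theorem intersection_of_homeomorphism_saturations_analytic
    (F : ℕ → Set (NonemptyCompacts (ℕ → unitInterval)))
    (hF : ∀ n, MeasureTheory.AnalyticSet (F n)) :
    MeasureTheory.AnalyticSet (⋂ n : ℕ,
      {K : NonemptyCompacts (ℕ → unitInterval) |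
        ∃ C ∈ F n,
          Nonempty (↥(K : Set (ℕ → unitInterval)) ≃ₜ ↥(C : Set (ℕ → unitInterval)))}) := by
  exact AnalyticSet.iInter fun n => (hF n).homeomorphism_saturation
end

section
/- Let X be a compact metrizable space. Then X has infinitely many connected components if and only if there exists a continuous surjection from X onto the one-point compactification ℕ ∪ {∞} of the discrete natural numbers (i.e. onto a convergent sequence together with its limit, the ordinal space ω + 1). -/
open Set Filter Topology TopologicalSpace

/-- A map into the one-point compactification of a discrete space is continuous as soon as
the fibres over the finite points are clopen. -/
theorem OnePoint.continuous_of_isClopen_preimage_singleton {Y D : Type*} [TopologicalSpace Y]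
    [TopologicalSpace D] [DiscreteTopology D] {f : Y → OnePoint D}
    (hf : ∀ d : D, IsClopen (f ⁻¹' {(d : OnePoint D)})) : Continuous f := by
  have preimage_image (t : Set D) :
      f ⁻¹' ((↑) '' t) = ⋃ d ∈ t, f ⁻¹' {(d : OnePoint D)} := by
    ext y
    simp [eq_comm]
  refine continuous_def.2 fun s hs => ?_
  by_cases h : OnePoint.infty ∈ s
  · have hfin : ((↑) ⁻¹' s : Set D)ᶜ.Finite :=
      isCompact_iff_finite.1 ((OnePoint.isOpen_iff_of_mem h).1 hs).2
    have hs' : s = ((↑) '' ((↑) ⁻¹' s : Set D)ᶜ)ᶜ := by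
      ext z
      induction z using OnePoint.rec <;> simp [h]
    rw [hs', preimage_compl, preimage_image, isOpen_compl_iff]
    exact hfin.isClosed_biUnion fun d _ => (hf d).isClosed
  · have hs' : s = (↑) '' ((↑) ⁻¹' s : Set D) := by
      ext z
      induction z using OnePoint.rec <;> simp [h]
    rw [hs', preimage_image]
    exact isOpen_biUnion fun d _ => (hf d).isOpen

/-- A continuous map to `OnePoint ℕ` with infinite range attaining `∞` can be relabelled to a
continuous surjection. -/
theorem OnePoint.exists_continuous_surjective_of_infinite_range {Y : Type*} [TopologicalSpace Y]
    {g : Y → OnePoint ℕ} (hg : Continuous g) (hinfty : OnePoint.infty ∈ range g)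
    (hinf : (range g).Infinite) : ∃ f : Y → OnePoint ℕ, Continuous f ∧ Function.Surjective f := by
  classical
  let p : ℕ → Prop := fun n => (n : OnePoint ℕ) ∈ range g
  have hp : (Set.ofPred p).Infinite := by
    intro hfin
    refine hinf (((hfin.image ((↑) : ℕ → OnePoint ℕ)).insert OnePoint.infty).subset ?_)
    intro z hz
    induction z using OnePoint.rec with
    | infty => exact mem_insert _ _
    | coe n => exact mem_insert_of_mem _ (mem_image_of_mem _ hz)
  have htendsto : Tendsto (Nat.count p) atTop atTop :=
    tendsto_atTop_atTop_of_monotone (Nat.count_monotone p) fun n =>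
      ⟨Nat.nth p n, (Nat.count_nth_of_infinite hp n).ge⟩
  have hcont : Continuous (OnePoint.map (Nat.count p)) :=
    OnePoint.continuous_map continuous_of_discreteTopology (by
      simpa [coclosedCompact_eq_cocompact, cocompact_eq_cofinite, Nat.cofinite_eq_atTop]
        using htendsto)
  refine ⟨OnePoint.map (Nat.count p) ∘ g, hcont.comp hg, fun z => ?_⟩
  induction z using OnePoint.rec with
  | infty =>
    obtain ⟨y, hy⟩ := hinfty
    exact ⟨y, by simp [hy]⟩
  | coe n =>
    obtain ⟨y, hy⟩ : p (Nat.nth p n) := Nat.nth_mem_of_infinite hp n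
    exact ⟨y, by simp [hy, Nat.count_nth_of_infinite hp n]⟩

/-- A non-isolated point that is the intersection of countably many clopen sets gives rise to a
continuous surjection onto `OnePoint ℕ`. -/
theorem exists_continuous_surjective_onePoint_of_iInter_isClopen {Y : Type*} [TopologicalSpace Y]
    {p : Y} (hp : ¬ IsOpen {p}) {V : ℕ → Set Y} (hV : ∀ n, IsClopen (V n))
    (hVp : ⋂ n, V n = {p}) : ∃ f : Y → OnePoint ℕ, Continuous f ∧ Function.Surjective f := by
  classical
  let g : Y → OnePoint ℕ := fun y => if h : ∃ n, y ∉ V n then ((Nat.find h : ℕ) : OnePoint ℕ)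
    else OnePoint.infty
  have hg_coe (y : Y) (n : ℕ) : g y = n ↔ y ∉ V n ∧ ∀ m < n, y ∈ V m := by
    by_cases h : ∃ n, y ∉ V n
    · simp [g, dif_pos h, Nat.find_eq_iff]
    · have hn : y ∈ V n := not_not.1 fun hn => h ⟨n, hn⟩
      simp [g, dif_neg h, hn]
  have hg_infty (y : Y) : g y = OnePoint.infty ↔ y = p := by
    rw [← mem_singleton_iff (b := p), ← hVp, mem_iInter]
    by_cases h : ∃ n, y ∉ V n
    · simpa [g, dif_pos h] using h
    · simpa [g, dif_neg h] using h
  refine OnePoint.exists_continuous_surjective_of_infinite_range (g := g)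
    (OnePoint.continuous_of_isClopen_preimage_singleton fun n => ?_)
    ⟨p, (hg_infty p).2 rfl⟩ fun hfin => hp ?_
  · have : g ⁻¹' {(n : OnePoint ℕ)} = (V n)ᶜ ∩ ⋂ m ∈ Iio n, V m := by
      ext y
      simp [hg_coe]
    rw [this]
    exact (hV n).compl.inter ((finite_Iio n).isClopen_biInter fun m _ => hV m)
  · have hfin' : ((↑) ⁻¹' range g : Set ℕ).Finite :=
      hfin.preimage OnePoint.coe_injective.injOn
    have : {p} = ⋂ m ∈ ((↑) ⁻¹' range g : Set ℕ), V m := by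
      refine (hVp ▸ subset_iInter₂ fun m _ => iInter_subset V m).antisymm fun y hy => ?_
      rw [mem_singleton_iff, ← hg_infty]
      by_contra h
      obtain ⟨n, hn⟩ := OnePoint.ne_infty_iff_exists.1 h
      exact ((hg_coe y n).1 hn.symm).1 (mem_iInter₂.1 hy n ⟨y, hn.symm⟩)
    rw [this]
    exact hfin'.isOpen_biInter fun m _ => (hV m).isOpen

/-- An infinite compact Hausdorff totally disconnected first-countable space maps continuously
onto `OnePoint ℕ`. -/
theorem exists_continuous_surjective_onePoint_of_infinite {Y : Type*} [TopologicalSpace Y]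
    [CompactSpace Y] [T2Space Y] [TotallyDisconnectedSpace Y] [FirstCountableTopology Y]
    [Infinite Y] : ∃ f : Y → OnePoint ℕ, Continuous f ∧ Function.Surjective f := by
  obtain ⟨p, hp⟩ : ∃ p : Y, ¬ IsOpen {p} := by
    by_contra! h
    have := discreteTopology_iff_isOpen_singleton.2 h
    exact not_finite_iff_infinite.2 ‹_› (finite_of_compact_of_discrete (X := Y))
  obtain ⟨U, hU⟩ := (𝓝 p).exists_antitone_basis
  choose V hV hVU using fun n => (nhds_basis_clopen p).mem_iff.1 (hU.mem n)
  refine exists_continuous_surjective_onePoint_of_iInter_isClopen hp (fun n => (hV n).2) ?_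
  refine Subset.antisymm (fun y hy => ?_)
    (singleton_subset_iff.2 (mem_iInter.2 fun n => (hV n).1))
  by_contra h
  obtain ⟨n, hn⟩ := hU.mem_iff.1 (isOpen_compl_singleton.mem_nhds (Ne.symm h) : {y}ᶜ ∈ 𝓝 p)
  exact hn (hVU n (mem_iInter.1 hy n)) rfl

/-- A compact second-countable space has only countably many clopen subsets. -/
theorem TopologicalSpace.Clopens.countable_of_secondCountable (X : Type*) [TopologicalSpace X]
    [CompactSpace X] [SecondCountableTopology X] : Countable (Clopens X) := by
  have : Countable (countableBasis X) := (countable_countableBasis X).to_subtype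
  choose t ht using fun s : Clopens X =>
    eq_sUnion_finset_of_isTopologicalBasis_of_isCompact_open _ (isBasis_countableBasis X) s
      s.isClopen.isClosed.isCompact s.isClopen.isOpen
  refine Function.Injective.countable (f := t) fun s s' h => SetLike.coe_injective ?_
  rw [ht s, ht s', h]

/-- The space of connected components of a compact Hausdorff second-countable space is second
countable. -/
theorem ConnectedComponents.secondCountableTopology (X : Type*) [TopologicalSpace X]
    [CompactSpace X] [T2Space X] [SecondCountableTopology X] :
    SecondCountableTopology (ConnectedComponents X) := by
  have := Clopens.countable_of_secondCountable X
  rw [← Clopens.countable_iff_secondCountable]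
  refine Function.Injective.countable
    (f := fun s : Clopens (ConnectedComponents X) =>
      (⟨_, s.isClopen.preimage ConnectedComponents.continuous_coe⟩ : Clopens X)) fun s t h => ?_
  exact SetLike.coe_injective
    (ConnectedComponents.surjective_coe.preimage_injective (congrArg Clopens.carrier h))

/-- The set of connected components is infinite iff the quotient space of components is. -/
theorem infinite_range_connectedComponent_iff (X : Type*) [TopologicalSpace X] :
    (range fun x : X => connectedComponent x).Infinite ↔ Infinite (ConnectedComponents X) := by
  let e : Quotient (Setoid.ker fun x : X => connectedComponent x) ≃
    range fun x : X => connectedComponent x := Setoid.quotientKerEquivRange _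
  rw [← infinite_coe_iff, ← e.infinite_iff]
  rfl


/-- A compact metrizable space has infinitely many connected components if and only if it
admits a continuous surjection onto the one-point compactification `ℕ ∪ {∞}` of the
discrete natural numbers (a convergent sequence with its limit). -/
theorem infinitely_many_components_iff_maps_onto_convergent_sequence
    (X : Type*) [TopologicalSpace X] [CompactSpace X] [TopologicalSpace.MetrizableSpace X] :
    (Set.range fun x : X => connectedComponent x).Infinite ↔
      ∃ f : X → OnePoint ℕ, Continuous f ∧ Function.Surjective f := by
  rw [infinite_range_connectedComponent_iff]
  constructor
  · intro _
    have : SecondCountableTopology (ConnectedComponents X) := by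
      let := metrizableSpaceMetric X
      exact ConnectedComponents.secondCountableTopology X
    obtain ⟨f, hf, hfs⟩ :=
      exists_continuous_surjective_onePoint_of_infinite (Y := ConnectedComponents X)
    exact ⟨_, hf.comp ConnectedComponents.continuous_coe,
      hfs.comp ConnectedComponents.surjective_coe⟩
  · rintro ⟨f, hf, hfs⟩
    refine Infinite.of_surjective hf.connectedComponentsLift fun z => ?_
    obtain ⟨x, rfl⟩ := hfs z
    exact ⟨x, hf.connectedComponentsLift_apply_coe x⟩
end
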